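/- arXiv:1707.05585 — 4 statements merged into one kernel-verified Lean document; each statement's English description precedes it below -/
import Mathlib

section
/- For every n ≥ 2 and all admissible indices, the Krammer matrices satisfy the braid relations and are invertible: M_n(σ_k)·M_n(σ_l) = M_n(σ_l)·M_n(σ_k) whenever |k − l| ≥ 2, M_n(σ_k)·M_n(σ_{k+1})·M_n(σ_k) = M_n(σ_{k+1})·M_n(σ_k)·M_n(σ_{k+1}) for 1 ≤ k ≤ n−2, and each M_n(σ_k) is an invertible m×m matrix over ℤ[q^{±1}, t^{±1}]; hence σ_k ↦ M_n(σ_k) defines a representation of the braid group B_n. -/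
noncomputable section

open Matrix

/-- The Laurent polynomial ring `ℤ[q^{±1}, t^{±1}]`, realized as iterated
Laurent polynomials over `ℤ`. -/
abbrev KR : Type := LaurentPolynomial (LaurentPolynomial ℤ)

/-- The variable `q` of `ℤ[q^{±1}, t^{±1}]`. -/
noncomputable def qv : KR := LaurentPolynomial.C (LaurentPolynomial.T 1)

/-- The variable `t` of `ℤ[q^{±1}, t^{±1}]`. -/
noncomputable def tv : KR := LaurentPolynomial.T 1

/-- The coefficient of `e_{i',j'}` in `K(σ_k)(e_{i,j})`, with 1-based indices,
over any commutative ring with chosen elements `q`, `t`. -/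
def krammerEntry {A : Type*} [CommRing A] (q t : A) (k i j i' j' : ℕ) : A :=
  if i = k ∧ j = k + 1 then
    (if i' = k ∧ j' = k + 1 then t * q ^ 2 else 0)
  else if j = k ∧ i < k then
    (if i' = i ∧ j' = k then 1 - q else if i' = i ∧ j' = k + 1 then q else 0)
  else if j = k + 1 ∧ i < k then
    (if i' = i ∧ j' = k then 1
     else if i' = k ∧ j' = k + 1 then t * q ^ (k - i + 1) * (q - 1) else 0)
  else if i = k ∧ k + 1 < j then
    (if i' = k ∧ j' = k + 1 then t * q * (q - 1)
     else if i' = k + 1 ∧ j' = j then q else 0)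
  else if i = k + 1 ∧ k + 1 < j then
    (if i' = k ∧ j' = j then 1 else if i' = k + 1 ∧ j' = j then 1 - q else 0)
  else if i < k ∧ k + 1 < j then
    (if i' = i ∧ j' = j then 1
     else if i' = k ∧ j' = k + 1 then t * q ^ (k - i) * (q - 1) ^ 2 else 0)
  else (if i' = i ∧ j' = j then 1 else 0)

/-- The index set of pairs `(i,j)` with `1 ≤ i < j ≤ n` (realized 0-based). -/
abbrev KIdx (n : ℕ) : Type := {p : Fin n × Fin n // p.1 < p.2}

/-- First (1-based) component `i` of an index pair. -/
def idx1 {n : ℕ} (a : KIdx n) : ℕ := a.val.1.val + 1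

/-- Second (1-based) component `j` of an index pair. -/
def idx2 {n : ℕ} (a : KIdx n) : ℕ := a.val.2.val + 1

/-- The Krammer matrix `M_n(σ_k)` over any commutative ring with chosen `q`, `t`:
the row indexed by `(i,j)` gives the image `K(σ_k)(e_{i,j})`. -/
def krammerMatrix {A : Type*} [CommRing A] (q t : A) (n k : ℕ) :
    Matrix (KIdx n) (KIdx n) A :=
  fun a b => krammerEntry q t k (idx1 a) (idx2 a) (idx1 b) (idx2 b)

/-- The Krammer matrix `M_n(σ_k)` over `ℤ[q^{±1}, t^{±1}]`. -/
noncomputable def M (n k : ℕ) : Matrix (KIdx n) (KIdx n) KR := krammerMatrix qv tv n k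

section KrammerOperator

variable {A : Type*} [CommRing A]

/-- The Krammer operator `K(σ_k)`, acting contravariantly on families `f` indexed by all pairs of
natural numbers: if `f i j` is the value of a linear functional on `e_{i,j}`, then
`krammerOp q t k f i j` is its value on `K(σ_k)(e_{i,j})`. -/
def krammerOp (q t : A) (k : ℕ) (f : ℕ → ℕ → A) (i j : ℕ) : A :=
  if i = k ∧ j = k + 1 then t * q ^ 2 * f k (k + 1)
  else if j = k ∧ i < k then (1 - q) * f i k + q * f i (k + 1)
  else if j = k + 1 ∧ i < k then f i k + t * q ^ (k - i + 1) * (q - 1) * f k (k + 1)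
  else if i = k ∧ k + 1 < j then t * q * (q - 1) * f k (k + 1) + q * f (k + 1) j
  else if i = k + 1 ∧ k + 1 < j then f k j + (1 - q) * f (k + 1) j
  else if i < k ∧ k + 1 < j then f i j + t * q ^ (k - i) * (q - 1) ^ 2 * f k (k + 1)
  else f i j

variable (q t : A) {k i j : ℕ} (f : ℕ → ℕ → A)

theorem krammerOp_self (hi : i = k) (hj : j = k + 1) :
    krammerOp q t k f i j = t * q ^ 2 * f k (k + 1) := by
  rw [krammerOp, if_pos ⟨hi, hj⟩]

theorem krammerOp_snd_eq (hj : j = k) (hi : i < k) :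
    krammerOp q t k f i j = (1 - q) * f i k + q * f i (k + 1) := by
  rw [krammerOp, if_neg (by omega), if_pos ⟨hj, hi⟩]

theorem krammerOp_snd_eq_succ (hj : j = k + 1) (hi : i < k) :
    krammerOp q t k f i j = f i k + t * q ^ (k - i + 1) * (q - 1) * f k (k + 1) := by
  rw [krammerOp, if_neg (by omega), if_neg (by omega), if_pos ⟨hj, hi⟩]

theorem krammerOp_fst_eq (hi : i = k) (hj : k + 1 < j) :
    krammerOp q t k f i j = t * q * (q - 1) * f k (k + 1) + q * f (k + 1) j := by
  rw [krammerOp, if_neg (by omega), if_neg (by omega), if_neg (by omega), if_pos ⟨hi, hj⟩]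

theorem krammerOp_fst_eq_succ (hi : i = k + 1) (hj : k + 1 < j) :
    krammerOp q t k f i j = f k j + (1 - q) * f (k + 1) j := by
  rw [krammerOp, if_neg (by omega), if_neg (by omega), if_neg (by omega), if_neg (by omega),
    if_pos ⟨hi, hj⟩]

theorem krammerOp_of_lt_of_lt (hi : i < k) (hj : k + 1 < j) :
    krammerOp q t k f i j = f i j + t * q ^ (k - i) * (q - 1) ^ 2 * f k (k + 1) := by
  rw [krammerOp, if_neg (by omega), if_neg (by omega), if_neg (by omega), if_neg (by omega),
    if_neg (by omega), if_pos ⟨hi, hj⟩]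

theorem krammerOp_of_disjoint (hij : i < j) (h : j < k ∨ k + 1 < i) :
    krammerOp q t k f i j = f i j := by
  rw [krammerOp, if_neg (by omega), if_neg (by omega), if_neg (by omega), if_neg (by omega),
    if_neg (by omega), if_neg (by omega)]

theorem krammerOp_comm {l : ℕ} (hkl : k + 2 ≤ l) (hij : i < j) :
    krammerOp q t k (krammerOp q t l f) i j = krammerOp q t l (krammerOp q t k f) i j := by
  have hi : i < k ∨ i = k ∨ i = k + 1 ∨ (k + 1 < i ∧ i < l) ∨ i = l ∨ i = l + 1 ∨ l + 1 < i := by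
    omega
  have hj : j < k ∨ j = k ∨ j = k + 1 ∨ (k + 1 < j ∧ j < l) ∨ j = l ∨ j = l + 1 ∨ l + 1 < j := by
    omega
  have hpow : q ^ (l - k) = q * q ^ (l - (k + 1)) := by
    rw [← pow_succ']; congr 1; omega
  rcases hi with hi | rfl | rfl | hi | rfl | rfl | hi <;>
  rcases hj with hj | rfl | rfl | hj | rfl | rfl | hj <;>
  first
  | omega
  | (simp (disch := omega) only [krammerOp_self, krammerOp_snd_eq, krammerOp_snd_eq_succ,
      krammerOp_fst_eq, krammerOp_fst_eq_succ, krammerOp_of_lt_of_lt, krammerOp_of_disjoint]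
     try simp only [pow_succ, hpow]
     try ring)

theorem krammerOp_braid (hij : i < j) :
    krammerOp q t k (krammerOp q t (k + 1) (krammerOp q t k f)) i j =
      krammerOp q t (k + 1) (krammerOp q t k (krammerOp q t (k + 1) f)) i j := by
  have hi : i < k ∨ i = k ∨ i = k + 1 ∨ i = k + 2 ∨ k + 2 < i := by omega
  have hj : j < k ∨ j = k ∨ j = k + 1 ∨ j = k + 2 ∨ k + 2 < j := by omega
  have hpow : i < k → q ^ (k + 1 - i) = q * q ^ (k - i) := fun h => by
    rw [← pow_succ']; congr 1; omega
  have hsub : k + 1 - k = 1 := by omega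
  rcases hi with hi | rfl | rfl | rfl | hi <;>
  rcases hj with hj | rfl | rfl | rfl | hj <;>
  first
  | omega
  | (simp (disch := omega) only [krammerOp_self, krammerOp_snd_eq, krammerOp_snd_eq_succ,
      krammerOp_fst_eq, krammerOp_fst_eq_succ, krammerOp_of_lt_of_lt, krammerOp_of_disjoint]
     try simp (disch := assumption) only [pow_succ, hsub, hpow]
     try ring)

/-- The inverse of `krammerOp q t k`, where `q'` and `t'` are inverses of `q` and `t`. -/
def krammerInv (q t q' t' : A) (k : ℕ) (g : ℕ → ℕ → A) (i j : ℕ) : A :=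
  let c := t' * q' ^ 2 * g k (k + 1)
  let x := fun i => g i (k + 1) - t * q ^ (k - i + 1) * (q - 1) * c
  let y := fun j => q' * (g k j - t * q * (q - 1) * c)
  if i = k ∧ j = k + 1 then c
  else if j = k ∧ i < k then x i
  else if j = k + 1 ∧ i < k then q' * (g i k - (1 - q) * x i)
  else if i = k ∧ k + 1 < j then g (k + 1) j - (1 - q) * y j
  else if i = k + 1 ∧ k + 1 < j then y j
  else if i < k ∧ k + 1 < j then g i j - t * q ^ (k - i) * (q - 1) ^ 2 * c
  else g i j

theorem krammerOp_krammerInv {q t q' t' : A} (hq : q * q' = 1) (ht : t * t' = 1)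
    (g : ℕ → ℕ → A) (hij : i < j) :
    krammerOp q t k (krammerInv q t q' t' k g) i j = g i j := by
  have hi : i < k ∨ i = k ∨ i = k + 1 ∨ k + 1 < i := by omega
  have hj : j < k ∨ j = k ∨ j = k + 1 ∨ k + 1 < j := by omega
  rcases hi with hi | rfl | rfl | hi <;>
  rcases hj with hj | rfl | rfl | hj <;>
  first
  | omega
  | (simp (disch := omega) only [krammerOp_self, krammerOp_snd_eq, krammerOp_snd_eq_succ,
      krammerOp_fst_eq, krammerOp_fst_eq_succ, krammerOp_of_lt_of_lt, krammerOp_of_disjoint,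
      krammerInv, if_pos, if_neg, and_self, true_and]
     try grind)

end KrammerOperator

section KrammerMatrix

variable {A : Type*} [CommRing A] {n : ℕ}

/-- The restriction of a family indexed by pairs of natural numbers to the pairs
`1 ≤ i < j ≤ n`. -/
def restrictIdx {B : Type*} (n : ℕ) (f : ℕ → ℕ → B) : KIdx n → B :=
  fun a => f (idx1 a) (idx2 a)

theorem idx1_lt_idx2 (a : KIdx n) : idx1 a < idx2 a :=
  Nat.succ_lt_succ a.2

theorem one_le_idx1 (a : KIdx n) : 1 ≤ idx1 a :=
  Nat.succ_le_succ (Nat.zero_le _)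

theorem idx2_le (a : KIdx n) : idx2 a ≤ n :=
  a.val.2.isLt

theorem exists_idx_eq {i j : ℕ} (hi : 1 ≤ i) (hij : i < j) (hj : j ≤ n) :
    ∃ a : KIdx n, idx1 a = i ∧ idx2 a = j :=
  ⟨⟨(⟨i - 1, by omega⟩, ⟨j - 1, by omega⟩), by simp only [Fin.lt_def]; omega⟩,
    Nat.sub_add_cancel hi, Nat.sub_add_cancel (by omega)⟩

theorem idx_injective {a b : KIdx n} (h₁ : idx1 a = idx1 b) (h₂ : idx2 a = idx2 b) : a = b :=
  Subtype.ext (Prod.ext (Fin.ext (Nat.succ_injective h₁)) (Fin.ext (Nat.succ_injective h₂)))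

theorem restrictIdx_congr {B : Type*} {f g : ℕ → ℕ → B} (h : ∀ i j, i < j → f i j = g i j) :
    restrictIdx n f = restrictIdx n g :=
  funext fun a => h _ _ (idx1_lt_idx2 a)

theorem restrictIdx_surjective : Function.Surjective (restrictIdx (B := A) n) := by
  classical
  intro v
  refine ⟨fun i j => ∑ a, if idx1 a = i ∧ idx2 a = j then v a else 0, funext fun a => ?_⟩
  rw [restrictIdx, Finset.sum_eq_single a]
  · simp
  · exact fun b _ hb => if_neg fun h => hb (idx_injective h.1 h.2)
  · simp

theorem sum_ite_idx_mul {i j : ℕ} (hi : 1 ≤ i) (hij : i < j) (hj : j ≤ n) (x : A)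
    (f : ℕ → ℕ → A) :
    ∑ b : KIdx n, (if idx1 b = i ∧ idx2 b = j then x else 0) * f (idx1 b) (idx2 b) =
      x * f i j := by
  obtain ⟨a, rfl, rfl⟩ := exists_idx_eq hi hij hj
  rw [Finset.sum_eq_single a]
  · simp
  · exact fun b _ hb => by rw [if_neg fun h => hb (idx_injective h.1 h.2), zero_mul]
  · simp

theorem sum_ite_ite_idx_mul {i j i' j' : ℕ} (hi : 1 ≤ i) (hij : i < j) (hj : j ≤ n)
    (hi' : 1 ≤ i') (hij' : i' < j') (hj' : j' ≤ n) (hne : ¬(i = i' ∧ j = j')) (x y : A)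
    (f : ℕ → ℕ → A) :
    ∑ b : KIdx n, (if idx1 b = i ∧ idx2 b = j then x
        else if idx1 b = i' ∧ idx2 b = j' then y else 0) * f (idx1 b) (idx2 b) =
      x * f i j + y * f i' j' := by
  rw [← sum_ite_idx_mul hi hij hj x f, ← sum_ite_idx_mul hi' hij' hj' y f,
    ← Finset.sum_add_distrib]
  refine Finset.sum_congr rfl fun b _ => ?_
  rw [← add_mul]
  congr 1
  split_ifs <;> first | omega | simp

theorem krammerMatrix_mulVec (q t : A) {k : ℕ} (hk : 1 ≤ k) (hkn : k + 1 ≤ n)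
    (f : ℕ → ℕ → A) :
    krammerMatrix q t n k *ᵥ restrictIdx n f = restrictIdx n (krammerOp q t k f) := by
  funext a
  have h₁ := one_le_idx1 a
  have h₂ := idx1_lt_idx2 a
  have h₃ := idx2_le a
  simp only [mulVec, dotProduct, krammerMatrix, restrictIdx, krammerEntry, krammerOp]
  split_ifs <;>
  first
  | rw [sum_ite_ite_idx_mul] <;> first | omega | ring
  | rw [sum_ite_idx_mul] <;> first | omega | ring

variable {q t : A} {k l : ℕ}

theorem krammerMatrix_mul_comm (hk : 1 ≤ k) (hkl : k + 2 ≤ l) (hl : l + 1 ≤ n) :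
    krammerMatrix q t n k * krammerMatrix q t n l =
      krammerMatrix q t n l * krammerMatrix q t n k := by
  refine mulVec_injective (funext fun v => ?_)
  obtain ⟨f, rfl⟩ := restrictIdx_surjective v
  simp only [← mulVec_mulVec]
  rw [krammerMatrix_mulVec q t (by omega) hl, krammerMatrix_mulVec q t hk (by omega),
    krammerMatrix_mulVec q t hk (by omega), krammerMatrix_mulVec q t (by omega) hl]
  exact restrictIdx_congr fun i j hij => krammerOp_comm q t f hkl hij

theorem krammerMatrix_braid (hk : 1 ≤ k) (hkn : k + 2 ≤ n) :
    krammerMatrix q t n k * krammerMatrix q t n (k + 1) * krammerMatrix q t n k =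
      krammerMatrix q t n (k + 1) * krammerMatrix q t n k * krammerMatrix q t n (k + 1) := by
  refine mulVec_injective (funext fun v => ?_)
  obtain ⟨f, rfl⟩ := restrictIdx_surjective v
  have h₀ := krammerMatrix_mulVec q t (n := n) hk (by omega)
  have h₁ := krammerMatrix_mulVec q t (n := n) (k := k + 1) (by omega) hkn
  simp only [← mulVec_mulVec, h₀, h₁]
  exact restrictIdx_congr fun i j hij => krammerOp_braid q t f hij

theorem isUnit_krammerMatrix (hq : IsUnit q) (ht : IsUnit t) (hk : 1 ≤ k) (hkn : k + 1 ≤ n) :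
    IsUnit (krammerMatrix q t n k) := by
  obtain ⟨q', hq'⟩ := hq.exists_right_inv
  obtain ⟨t', ht'⟩ := ht.exists_right_inv
  refine mulVec_surjective_iff_isUnit.mp fun v => ?_
  obtain ⟨g, rfl⟩ := restrictIdx_surjective v
  refine ⟨restrictIdx n (krammerInv q t q' t' k g), ?_⟩
  rw [krammerMatrix_mulVec q t hk hkn]
  exact restrictIdx_congr fun i j hij => krammerOp_krammerInv hq' ht' g hij

end KrammerMatrix

theorem isUnit_tv : IsUnit tv :=
  LaurentPolynomial.isUnit_T 1

theorem isUnit_qv : IsUnit qv :=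
  (LaurentPolynomial.isUnit_T 1).map LaurentPolynomial.C

/-- the Krammer matrices satisfy the braid relations and are
invertible, hence `σ_k ↦ M_n(σ_k)` defines a representation of `B_n`. -/
theorem krammer_matrices_define_representation (n : ℕ) (hn : 2 ≤ n) :
    (∀ k l : ℕ, 1 ≤ k → k ≤ n - 1 → 1 ≤ l → l ≤ n - 1 → (k + 2 ≤ l ∨ l + 2 ≤ k) →
      M n k * M n l = M n l * M n k) ∧
    (∀ k : ℕ, 1 ≤ k → k ≤ n - 2 →
      M n k * M n (k + 1) * M n k = M n (k + 1) * M n k * M n (k + 1)) ∧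
    (∀ k : ℕ, 1 ≤ k → k ≤ n - 1 → IsUnit (M n k)) := by
  refine ⟨fun k l hk hkn hl hln h => ?_, fun k hk hkn => krammerMatrix_braid hk (by omega),
    fun k hk hkn => isUnit_krammerMatrix isUnit_qv isUnit_tv hk (by omega)⟩
  rcases h with h | h
  · exact krammerMatrix_mul_comm hk h (by omega)
  · exact (krammerMatrix_mul_comm hl h (by omega)).symm
end
end

section
/- (Theorem 1: the Krammer polynomial of an essential braid is zero.) Let n ≥ 2 and fix i ∈ {1, …, n−1}. For every matrix B that is a finite product of matrices from {M_n(σ_k)^{±1} : 1 ≤ k ≤ n−1, k ≠ i} (i.e., the Krammer image of a braid word omitting the generator σ_i), one has det(B − I_m) = 0, where I_m is the m×m identity matrix. -/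
noncomputable section

open Matrix

/-- The value at `(a, b)` of the functional fixed by all Krammer generators except `σ_p`. -/
def fixedWeight {A : Type*} [CommRing A] (q : A) (p a b : ℕ) : A :=
  if a ≤ p ∧ p < b then q ^ (p - a) else 0

lemma sum_ite_idx {A : Type*} [CommRing A] {n x y : ℕ} (hx : 1 ≤ x) (hxy : x < y)
    (hy : y ≤ n) (c : A) (w : ℕ → ℕ → A) :
    ∑ b : KIdx n, (if idx1 b = x ∧ idx2 b = y then c else 0) * w (idx1 b) (idx2 b) =
      c * w x y := by
  let b₀ : KIdx n := ⟨(⟨x - 1, by omega⟩, ⟨y - 1, by omega⟩), by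
    simp only [Fin.mk_lt_mk]; omega⟩
  have h1 : idx1 b₀ = x := by simp only [idx1, b₀]; omega
  have h2 : idx2 b₀ = y := by simp only [idx2, b₀]; omega
  rw [Finset.sum_eq_single b₀]
  · simp [h1, h2]
  · rintro b - hb
    rw [if_neg, zero_mul]
    rintro ⟨h3, h4⟩
    refine hb (Subtype.ext (Prod.ext (Fin.ext ?_) (Fin.ext ?_)))
    · simp only [idx1] at h1 h3; omega
    · simp only [idx2] at h2 h4; omega
  · simp

lemma sum_ite_ite_idx {A : Type*} [CommRing A] {n x y x' y' : ℕ} (hx : 1 ≤ x) (hxy : x < y)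
    (hy : y ≤ n) (hx' : 1 ≤ x') (hxy' : x' < y') (hy' : y' ≤ n) (hne : x = x' → y ≠ y')
    (c d : A) (w : ℕ → ℕ → A) :
    ∑ b : KIdx n, (if idx1 b = x ∧ idx2 b = y then c
      else if idx1 b = x' ∧ idx2 b = y' then d else 0) * w (idx1 b) (idx2 b) =
      c * w x y + d * w x' y' := by
  rw [← sum_ite_idx hx hxy hy c w, ← sum_ite_idx hx' hxy' hy' d w, ← Finset.sum_add_distrib]
  refine Finset.sum_congr rfl fun b _ => ?_
  by_cases h : idx1 b = x ∧ idx2 b = y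
  · simp [h]
    omega
  · simp [h]

lemma krammerMatrix_mulVec_fixedWeight {A : Type*} [CommRing A] (q t : A) {n k p : ℕ}
    (hk1 : 1 ≤ k) (hk2 : k ≤ n - 1) (hkp : k ≠ p) :
    krammerMatrix q t n k *ᵥ (fun b => fixedWeight q p (idx1 b) (idx2 b)) =
      fun b => fixedWeight q p (idx1 b) (idx2 b) := by
  have hdiag : fixedWeight q p k (k + 1) = 0 := if_neg (by omega)
  have hright (i : ℕ) : fixedWeight q p i (k + 1) = fixedWeight q p i k := by
    simp only [fixedWeight]
    congr 1
    simp only [eq_iff_iff]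
    omega
  have hleft (j : ℕ) : fixedWeight q p k j = q * fixedWeight q p (k + 1) j := by
    by_cases h : k + 1 ≤ p ∧ p < j
    · rw [fixedWeight, fixedWeight, if_pos h, if_pos (by omega), ← pow_succ']
      congr 1
      omega
    · rw [fixedWeight, fixedWeight, if_neg h, if_neg (by omega), mul_zero]
  funext a
  have ha1 : 1 ≤ idx1 a := by simp [idx1]
  have ha2 : idx1 a < idx2 a := by simpa [idx1, idx2] using a.2
  have ha3 : idx2 a ≤ n := a.val.2.isLt
  simp only [mulVec, dotProduct, krammerMatrix]
  generalize idx1 a = i at *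
  generalize idx2 a = j at *
  unfold krammerEntry
  split_ifs with h1 h2 h3 h4 h5 h6
  · obtain ⟨rfl, rfl⟩ := h1
    rw [sum_ite_idx (by omega) (by omega) (by omega), hdiag, mul_zero]
  · obtain ⟨rfl, h2⟩ := h2
    rw [sum_ite_ite_idx (by omega) (by omega) (by omega) (by omega) (by omega) (by omega)
      (by omega), hright]
    ring
  · obtain ⟨rfl, h3⟩ := h3
    rw [sum_ite_ite_idx (by omega) (by omega) (by omega) (by omega) (by omega) (by omega)
      (by omega), hdiag, hright]
    ring
  · obtain ⟨rfl, h4⟩ := h4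
    rw [sum_ite_ite_idx (by omega) (by omega) (by omega) (by omega) (by omega) (by omega)
      (by omega), hdiag, hleft]
    ring
  · obtain ⟨rfl, h5⟩ := h5
    rw [sum_ite_ite_idx (by omega) (by omega) (by omega) (by omega) (by omega) (by omega)
      (by omega), hleft]
    ring
  · rw [sum_ite_ite_idx (by omega) (by omega) (by omega) (by omega) (by omega) (by omega)
      (by omega), hdiag]
    ring
  · rw [sum_ite_idx (by omega) (by omega) (by omega), one_mul]

/-- Theorem 1: the Krammer polynomial of an essential braid is zero.
If `B` is a finite product of matrices `M_n(σ_k)^{±1}` with `k ≠ i`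
(the Krammer image of a braid word omitting the generator `σ_i`), then
`det(B − I_m) = 0`. -/
theorem krammer_polynomial_of_essential_braid_eq_zero
    (n i : ℕ) (hn : 2 ≤ n) (hi1 : 1 ≤ i) (hi2 : i ≤ n - 1)
    (B : (Matrix (KIdx n) (KIdx n) KR)ˣ)
    (hB : B ∈ Subgroup.closure {u : (Matrix (KIdx n) (KIdx n) KR)ˣ |
      ∃ k : ℕ, 1 ≤ k ∧ k ≤ n - 1 ∧ k ≠ i ∧ (u : Matrix (KIdx n) (KIdx n) KR) = M n k}) :
    ((B : Matrix (KIdx n) (KIdx n) KR) - 1).det = 0 := by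
  let v : KIdx n → KR := fun b => fixedWeight qv i (idx1 b) (idx2 b)
  have hv : v ≠ 0 := fun h => by
    have := congrFun h ⟨(⟨i - 1, by omega⟩, ⟨i, by omega⟩), by
      simp only [Fin.mk_lt_mk]; omega⟩
    simp [v, fixedWeight, idx1, idx2, Nat.sub_add_cancel hi1] at this
    omega
  have hfix : (B : Matrix (KIdx n) (KIdx n) KR) *ᵥ v = v := by
    induction hB using Subgroup.closure_induction with
    | mem u hu =>
      obtain ⟨k, hk1, hk2, hki, hu⟩ := hu
      rw [hu]
      exact krammerMatrix_mulVec_fixedWeight qv tv hk1 hk2 hki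
    | one => simp
    | mul x y _ _ hx hy => rw [Units.val_mul, ← mulVec_mulVec, hy, hx]
    | inv x _ hx =>
      nth_rewrite 1 [← hx]
      rw [mulVec_mulVec, Units.inv_mul, one_mulVec]
  exact exists_mulVec_eq_zero_iff.mp ⟨v, hv, by rw [sub_mulVec, hfix, one_mulVec, sub_self]⟩
end
end

section
/- (Determinant factorization for words omitting σ_1; Case 1 of Theorem 1.) Let n ≥ 3 and let i_1, …, i_r be any finite sequence with each i_k ∈ {2, …, n−1}. Then det( M_n(σ_{i_1}) ⋯ M_n(σ_{i_r}) − I_m ) = det( B − I_{n−1} ) · det( M_{n−1}(σ_{i_1−1}) ⋯ M_{n−1}(σ_{i_r−1}) − I_{m′} ), where m′ = (n−1)(n−2)/2 and B is the product, in the same order, of the (n−1)×(n−1) matrices induced by each M_n(σ_{i_k}) on the quotient by the span of {e_{i,j} : i ≥ 2} (each such induced matrix equals β_{i_k} up to the convention for the matrix of a linear map). In particular this determinant is zero. -/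
noncomputable section

open Matrix

/-- For `2 ≤ i ≤ n−1`, the `(n−1)×(n−1)` matrix
`β_i = I_{i−2} ⊕ [[1−q, q],[1, 0]] ⊕ I_{n−i−1}`: the identity except in rows and
columns `i−1` and `i` (1-based), where it carries the block `[[1−q, q],[1, 0]]`. -/
def beta {A : Type*} [CommRing A] (q : A) (n i : ℕ) :
    Matrix (Fin (n - 1)) (Fin (n - 1)) A :=
  fun a b =>
    if a.val + 1 = i - 1 ∧ b.val + 1 = i - 1 then 1 - q
    else if a.val + 1 = i - 1 ∧ b.val + 1 = i then q
    else if a.val + 1 = i ∧ b.val + 1 = i - 1 then 1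
    else if a.val + 1 = i ∧ b.val + 1 = i then 0
    else if a = b then 1 else 0

/-- The index pairs of size `N + 1` split into those with first component `1` and those with
first component at least `2`; the latter are the shifted index pairs of size `N`. -/
def kIdxSuccEquiv (N : ℕ) : Fin N ⊕ KIdx N ≃ KIdx (N + 1) :=
  Equiv.ofBijective
    (Sum.elim (fun j => ⟨(0, j.succ), Fin.succ_pos j⟩)
      (fun p => ⟨(p.val.1.succ, p.val.2.succ), Fin.succ_lt_succ_iff.2 p.property⟩)) <| by
    constructor
    · rintro (a | ⟨⟨a, b⟩, hab⟩) (c | ⟨⟨c, d⟩, hcd⟩) h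
      · simpa using h
      · simp [(Fin.succ_ne_zero c).symm] at h
      · simp at h
      · simpa using h
    · rintro ⟨⟨i, j⟩, h⟩
      have hj : j ≠ 0 := (lt_of_le_of_lt (Fin.zero_le i) h).ne'
      obtain ⟨j, rfl⟩ := Fin.exists_succ_eq.2 hj
      by_cases hi : i = 0
      · subst hi
        exact ⟨Sum.inl j, rfl⟩
      · obtain ⟨i, rfl⟩ := Fin.exists_succ_eq.2 hi
        exact ⟨Sum.inr ⟨(i, j), Fin.succ_lt_succ_iff.1 h⟩, rfl⟩

theorem idx1_kIdxSuccEquiv_inl {N : ℕ} (j : Fin N) : idx1 (kIdxSuccEquiv N (Sum.inl j)) = 1 := rfl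

theorem idx2_kIdxSuccEquiv_inl {N : ℕ} (j : Fin N) :
    idx2 (kIdxSuccEquiv N (Sum.inl j)) = j.val + 2 := rfl

theorem idx1_kIdxSuccEquiv_inr {N : ℕ} (p : KIdx N) :
    idx1 (kIdxSuccEquiv N (Sum.inr p)) = idx1 p + 1 := rfl

theorem idx2_kIdxSuccEquiv_inr {N : ℕ} (p : KIdx N) :
    idx2 (kIdxSuccEquiv N (Sum.inr p)) = idx2 p + 1 := rfl

/-- For `k ≥ 2` the matrix `M_{N+1}(σ_k)` is block upper triangular, with diagonal blocks
`β_k` and `M_N(σ_{k-1})`. -/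
theorem krammerMatrix_submatrix_kIdxSuccEquiv {A : Type*} [CommRing A] (q t : A) (N k : ℕ)
    (hk : 2 ≤ k) :
    ∃ C, (krammerMatrix q t (N + 1) k).submatrix (kIdxSuccEquiv N) (kIdxSuccEquiv N) =
      fromBlocks (beta q (N + 1) k) C 0 (krammerMatrix q t N (k - 1)) := by
  obtain ⟨k, rfl⟩ : ∃ m, k = m + 2 := ⟨k - 2, by omega⟩
  refine ⟨((krammerMatrix q t (N + 1) (k + 2)).submatrix (kIdxSuccEquiv N)
    (kIdxSuccEquiv N)).toBlocks₁₂, ?_⟩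
  ext (a | a) (b | b)
  · simp only [submatrix_apply, fromBlocks_apply₁₁, krammerMatrix, krammerEntry, beta,
      idx1_kIdxSuccEquiv_inl, idx2_kIdxSuccEquiv_inl, Fin.ext_iff]
    split_ifs <;> grind
  · rfl
  · simp only [submatrix_apply, fromBlocks_apply₂₁, krammerMatrix, krammerEntry,
      idx1_kIdxSuccEquiv_inl, idx2_kIdxSuccEquiv_inl, idx1_kIdxSuccEquiv_inr,
      idx2_kIdxSuccEquiv_inr, Matrix.zero_apply]
    have ha : 1 ≤ idx1 a := Nat.succ_pos _
    split_ifs <;> grind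
  · simp only [submatrix_apply, fromBlocks_apply₂₂, krammerMatrix, krammerEntry,
      idx1_kIdxSuccEquiv_inr, idx2_kIdxSuccEquiv_inr, show k + 2 - 1 = k + 1 from rfl,
      show k + 2 = (k + 1) + 1 from rfl, Nat.add_sub_add_right, Nat.add_left_inj,
      Nat.add_lt_add_iff_right]

theorem prod_krammerMatrix_submatrix_kIdxSuccEquiv {A : Type*} [CommRing A] (q t : A) (N : ℕ)
    (l : List ℕ) (hl : ∀ i ∈ l, 2 ≤ i) :
    ∃ C, (l.map (krammerMatrix q t (N + 1))).prod.submatrix (kIdxSuccEquiv N) (kIdxSuccEquiv N) =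
      fromBlocks (l.map (beta q (N + 1))).prod C 0
        (l.map (fun i => krammerMatrix q t N (i - 1))).prod := by
  induction l with
  | nil => exact ⟨0, by simp [fromBlocks_one]⟩
  | cons k l ih =>
    obtain ⟨C, hC⟩ := ih fun i hi => hl i (List.mem_cons_of_mem k hi)
    obtain ⟨D, hD⟩ := krammerMatrix_submatrix_kIdxSuccEquiv q t N k (hl k List.mem_cons_self)
    refine ⟨beta q (N + 1) k * C + D * (l.map (fun i => krammerMatrix q t N (i - 1))).prod, ?_⟩
    simp only [List.map_cons, List.prod_cons]
    rw [← submatrix_mul_equiv _ _ _ (kIdxSuccEquiv N), hC, hD]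
    erw [fromBlocks_multiply]
    simp

theorem beta_mulVec_one {A : Type*} [CommRing A] (q : A) (n i : ℕ) (hi : 2 ≤ i) (hin : i ≤ n - 1) :
    beta q n i *ᵥ 1 = 1 := by
  ext a
  obtain ⟨k, rfl⟩ : ∃ k, i = k + 2 := ⟨i - 2, by omega⟩
  let u : Fin (n - 1) := ⟨k, by omega⟩
  let v : Fin (n - 1) := ⟨k + 1, by omega⟩
  change ∑ b, beta q n (k + 2) a b * 1 = 1
  simp only [mul_one]
  by_cases hu : a = u
  · have h : ∀ b, beta q n (k + 2) a b = (if b = u then 1 - q else 0) + if b = v then q else 0 := by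
      intro b
      simp only [beta, hu, u, v, Fin.ext_iff]
      split_ifs <;> grind
    simp [h, Finset.sum_add_distrib]
  · by_cases hv : a = v
    · have h : ∀ b, beta q n (k + 2) a b = if b = u then 1 else 0 := by
        intro b
        simp only [beta, hv, u, v, Fin.ext_iff]
        split_ifs <;> grind
      simp [h]
    · have h : ∀ b, beta q n (k + 2) a b = if a = b then 1 else 0 := by
        intro b
        simp only [u, v, Fin.ext_iff] at hu hv
        simp only [beta, Fin.ext_iff]
        split_ifs <;> grind
      simp [h]

theorem det_prod_beta_sub_one {A : Type*} [CommRing A] [IsDomain A] (q : A) (n : ℕ) (hn : 2 ≤ n)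
    (l : List ℕ) (hl : ∀ i ∈ l, 2 ≤ i ∧ i ≤ n - 1) :
    ((l.map (beta q n)).prod - 1).det = 0 := by
  have h : (l.map (beta q n)).prod *ᵥ 1 = 1 := by
    induction l with
    | nil => simp
    | cons k l ih =>
      obtain ⟨h₁, h₂⟩ := hl k List.mem_cons_self
      rw [List.map_cons, List.prod_cons, ← mulVec_mulVec,
        ih fun i hi => hl i (List.mem_cons_of_mem k hi), beta_mulVec_one q n k h₁ h₂]
  refine exists_mulVec_eq_zero_iff.1 ⟨1, ?_, ?_⟩
  · exact fun h0 => one_ne_zero (congrFun h0 ⟨0, by omega⟩)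
  · rw [sub_mulVec, h, one_mulVec, sub_self]

/-- Case 1 of Theorem 1: for a word in the generators
`σ_{i_1}, …, σ_{i_r}` with each `i_k ∈ {2,…,n−1}` (omitting `σ_1`),
`det(M_n(σ_{i_1})⋯M_n(σ_{i_r}) − I_m)` factors as
`det(B − I_{n−1})·det(M_{n−1}(σ_{i_1−1})⋯M_{n−1}(σ_{i_r−1}) − I_{m'})`, where
`B = β_{i_1}⋯β_{i_r}` is the product of the matrices induced on the quotient by
the span of `{e_{i,j} : i ≥ 2}`; in particular the determinant is zero. -/
theorem krammer_det_factorization_omit_sigma_one (n : ℕ) (hn : 3 ≤ n)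
    (l : List ℕ) (hl : ∀ i ∈ l, 2 ≤ i ∧ i ≤ n - 1) :
    ((l.map (M n)).prod - 1).det =
      ((l.map (beta qv n)).prod - 1).det *
        ((l.map (fun i => M (n - 1) (i - 1))).prod - 1).det ∧
    ((l.map (M n)).prod - 1).det = 0 := by
  have hdet := det_prod_beta_sub_one qv n (by omega) l hl
  suffices h : ((l.map (M n)).prod - 1).det =
      ((l.map (beta qv n)).prod - 1).det *
        ((l.map (fun i => M (n - 1) (i - 1))).prod - 1).det from
    ⟨h, by rw [h, hdet, zero_mul]⟩
  clear hdet
  obtain ⟨N, rfl⟩ : ∃ N, n = N + 1 := ⟨n - 1, by omega⟩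
  obtain ⟨C, hC⟩ := prod_krammerMatrix_submatrix_kIdxSuccEquiv qv tv N l fun i hi => (hl i hi).1
  rw [← det_submatrix_equiv_self (kIdxSuccEquiv N), submatrix_sub, Pi.sub_apply, Pi.sub_apply,
    submatrix_one_equiv]
  change (((l.map (krammerMatrix qv tv (N + 1))).prod.submatrix _ _) - 1).det = _
  have hsub : fromBlocks (l.map (beta qv (N + 1))).prod C 0
        (l.map (fun i => krammerMatrix qv tv N (i - 1))).prod - 1 =
      fromBlocks ((l.map (beta qv (N + 1))).prod - 1) C 0
        ((l.map (fun i => krammerMatrix qv tv N (i - 1))).prod - 1) := by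
    rw [← fromBlocks_one, sub_eq_add_neg, fromBlocks_neg, fromBlocks_add]
    simp only [neg_zero, add_zero, sub_eq_add_neg]
  rw [hC]
  exact (congrArg det hsub).trans (det_fromBlocks_zero₂₁ _ _ _)
end
end

section
/- (Krammer polynomial of the trigonal curve (y−x³)(y+x³)(y−4x) around its singular fiber x = 0.) For n = 3, let B = M_3(σ_1) M_3(σ_2) M_3(σ_1) M_3(σ_2)⁴ M_3(σ_1) M_3(σ_2) M_3(σ_1), the Krammer image of the braid monodromy σ_1σ_2σ_1(σ_2)⁴σ_1σ_2σ_1. Then det(B − I_3) = (t⁶q^{14} − 1)(t²q^{10} − 1)(t²q⁶ − 1) in ℤ[q^{±1}, t^{±1}]. -/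
noncomputable section

open Matrix

/-- The three index pairs for `n = 3`, in the order `(1,2), (1,3), (2,3)`. -/
def kIdxThreeEquiv : Fin 3 ≃ KIdx 3 where
  toFun := ![⟨(0, 1), by decide⟩, ⟨(0, 2), by decide⟩, ⟨(1, 2), by decide⟩]
  invFun p := if p.val.2 = 1 then 0 else if p.val.1 = 0 then 1 else 2
  left_inv := by decide
  right_inv := by decide

section

variable {A : Type*} [CommRing A] (q t : A)

theorem krammerMatrix_three_one :
    (krammerMatrix q t 3 1).submatrix kIdxThreeEquiv kIdxThreeEquiv =
      !![t * q ^ 2, 0, 0; t * q * (q - 1), 0, q; 0, 1, 1 - q] := by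
  ext i j
  fin_cases i <;> fin_cases j <;>
    simp [krammerMatrix, krammerEntry, kIdxThreeEquiv, idx1, idx2]

theorem krammerMatrix_three_two :
    (krammerMatrix q t 3 2).submatrix kIdxThreeEquiv kIdxThreeEquiv =
      !![1 - q, q, 0; 1, 0, t * q ^ 2 * (q - 1); 0, 0, t * q ^ 2] := by
  ext i j
  fin_cases i <;> fin_cases j <;>
    simp [krammerMatrix, krammerEntry, kIdxThreeEquiv, idx1, idx2]

/-- The Krammer image of the half twist `σ₁σ₂σ₁` on three strands. -/
theorem krammer_halfTwist_three :
    (!![t * q ^ 2, 0, 0; t * q * (q - 1), 0, q; 0, 1, 1 - q] : Matrix (Fin 3) (Fin 3) A) *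
        !![1 - q, q, 0; 1, 0, t * q ^ 2 * (q - 1); 0, 0, t * q ^ 2] *
        !![t * q ^ 2, 0, 0; t * q * (q - 1), 0, q; 0, 1, 1 - q] =
      !![0, 0, t * q ^ 4; 0, t * q ^ 3, 0; t * q ^ 2, 0, 0] := by
  ext i j
  fin_cases i <;> fin_cases j <;>
    simp [Matrix.mul_apply, Fin.sum_univ_three] <;> ring

theorem krammer_two_sq_three :
    (!![1 - q, q, 0; 1, 0, t * q ^ 2 * (q - 1); 0, 0, t * q ^ 2] :
        Matrix (Fin 3) (Fin 3) A) ^ 2 =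
      !![1 - q + q ^ 2, q * (1 - q), t * q ^ 3 * (q - 1);
        1 - q, q, t ^ 2 * q ^ 4 * (q - 1); 0, 0, t ^ 2 * q ^ 4] := by
  ext i j
  fin_cases i <;> fin_cases j <;>
    simp [pow_two, Matrix.mul_apply, Fin.sum_univ_three] <;> ring

/-- The Krammer polynomial of `σ₁σ₂σ₁(σ₂)⁴σ₁σ₂σ₁` over any commutative ring. -/
theorem det_krammerMatrix_trigonal :
    (krammerMatrix q t 3 1 * krammerMatrix q t 3 2 * krammerMatrix q t 3 1 *
        krammerMatrix q t 3 2 ^ 4 * krammerMatrix q t 3 1 * krammerMatrix q t 3 2 *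
        krammerMatrix q t 3 1 - 1).det =
      (t ^ 6 * q ^ 14 - 1) * (t ^ 2 * q ^ 10 - 1) * (t ^ 2 * q ^ 6 - 1) := by
  have h₁ := krammerMatrix_three_one q t
  have h₂ := krammerMatrix_three_two q t
  set X := (krammerMatrix q t 3 1).submatrix kIdxThreeEquiv kIdxThreeEquiv
  set Y := (krammerMatrix q t 3 2).submatrix kIdxThreeEquiv kIdxThreeEquiv
  have hXY : X * Y * X = !![0, 0, t * q ^ 4; 0, t * q ^ 3, 0; t * q ^ 2, 0, 0] := by
    rw [h₁, h₂, krammer_halfTwist_three]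
  have hY : Y ^ 2 = !![1 - q + q ^ 2, q * (1 - q), t * q ^ 3 * (q - 1);
      1 - q, q, t ^ 2 * q ^ 4 * (q - 1); 0, 0, t ^ 2 * q ^ 4] := by
    rw [h₂, krammer_two_sq_three]
  let e := Matrix.reindexAlgEquiv A A kIdxThreeEquiv.symm
  have hX' : e (krammerMatrix q t 3 1) = X := rfl
  have hY' : e (krammerMatrix q t 3 2) = Y := rfl
  rw [← Matrix.det_reindexAlgEquiv A A kIdxThreeEquiv.symm]
  change (e _).det = _
  simp only [map_sub, map_mul, map_pow, map_one, hX', hY']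
  rw [show X * Y * X * Y ^ 4 * X * Y * X = X * Y * X * (Y ^ 2 * Y ^ 2) * (X * Y * X) by
    rw [← pow_add]; simp only [mul_assoc], hXY, hY, Matrix.det_fin_three]
  simp
  ring

end

/-- the local Krammer polynomial of the trigonal curve
`(y−x³)(y+x³)(y−4x)` around its singular fiber `x = 0`, whose braid monodromy is
`σ₁σ₂σ₁(σ₂)⁴σ₁σ₂σ₁`, equals `(t⁶q¹⁴ − 1)(t²q¹⁰ − 1)(t²q⁶ − 1)`. -/
theorem krammer_polynomial_trigonal_example :
    ((M 3 1 * M 3 2 * M 3 1 * (M 3 2) ^ 4 * M 3 1 * M 3 2 * M 3 1) - 1).det =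
      (tv ^ 6 * qv ^ 14 - 1) * (tv ^ 2 * qv ^ 10 - 1) * (tv ^ 2 * qv ^ 6 - 1) := by
  exact det_krammerMatrix_trigonal qv tv
end
end
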